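/- arXiv:1302.1632 — 2 statements merged into one kernel-verified Lean document; each statement's English description precedes it below -/
import Mathlib

section
/- Let n ≥ 1 be an integer and s, u ∈ ℂ with s ≠ 0 and u ≠ 0. Define A = [[s, −2, −1/s],[0, 1, 1/s],[0, 0, 1/s]], B = [[s, 0, 0],[s·u, 1, 0],[−s·u², −2u, 1/s]], W = B·A⁻¹·B⁻¹·A, and Ω = I + W⁻¹ + ⋯ + W^{−(n−1)}. Let ξ₊, ξ₋ ∈ ℂ with ξ₊ξ₋ = 1, ξ₊ ≠ ξ₋, ξ₊ + ξ₋ = 2 + 2u − u/s − su + u², set X = (ξ₊ⁿ − ξ₋ⁿ)/(ξ₊ − ξ₋), Y = (ξ₊^{n−1} − ξ₋^{n−1})/(ξ₊ − ξ₋), and assume the Riley equation (s + 1/s − 1 − u)·X = Y holds. Assume also D₀ := s²u(1 − 2s + s² − su)(−4s + u − 2su + s²u − su²) ≠ 0 and u + 1 − 1/s ≠ 0. Then Ω = (1/D₀)·[ω_{ij}] where: ω₁₁ = s²u{(1−2s+s²−su)(2−4s+2s²+u−6su+s²u−4s³u−su²+3s²u²−s³u²+s⁴u²−s³u³)X² −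 2ns(−1+s+su)²}; ω₁₂ = −2su(−1+s+su){(1−2s+s²−su)(−1−3s²+2su−s²u+s³u−s²u²)X² − ns(−1+2s+s²+su)}; ω₁₃ = −(−1+s+su)²{(1−2s+s²−su)(−2s+u−su+s²u−su²)X² − 2ns²}; ω₂₁ = s²u²(−1+s+su){(1−2s+s²−su)(−1−3s²+2su−s²u+s³u−s²u²)X² − ns(−1+2s+s²+su)}; ω₂₂ = −su{2(1−2s+s²−su)(−1+s+su)²(−2s+u−su+s²u−su²)X² − nsu(−1+2s+s²+su)²}; ω₂₃ = −u(−1+s+su){(1−2s+s²−su)(−1+s+su)(−3s+s²+u−2su+s²u−su²)X² − ns²(−1+2s+s²+su)}; ω₃₁ = −s²u²(−1+s+su)²{(1−2s+s²−su)(−2s+u−su+s²u−su²)X² − 2ns²}; ω₃₂ = 2su²(−1+s+su){(1−2s+s²−su)(−1+s+su)(−3s+s²+u−2su+s²u−su²)X² − ns²(−1+2s+s²+su)}; ω₃₃ = u(−1+s+su){(1−2s+s²−su)(−2s²+2s³+4su−9s²u+3s³u−u²+4su²−9s²u²+3s³u²+2su³−4s²u³+s³u³−s²u⁴)X² − 2ns³(−1+s+su)}.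 -/
open Matrix

/-- The action `Z ↦ M Z adj(M)` of `M = !![p, q; r, v]` on `sl₂` in the basis `E, H, F`. For
`det M = 1` this is the adjoint action of `M`. -/
def slTwoAdjoint {R : Type*} [CommRing R] (p q r v : R) : Matrix (Fin 3) (Fin 3) R :=
  !![p ^ 2, -(2 * p * q), -q ^ 2; -(p * r), p * v + q * r, q * v; -r ^ 2, 2 * r * v, v ^ 2]

section CommRing

variable {R : Type*} [CommRing R]

lemma slTwoAdjoint_mul (p q r v p' q' r' v' : R) :
    slTwoAdjoint p q r v * slTwoAdjoint p' q' r' v' =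
      slTwoAdjoint (p * p' + q * r') (p * q' + q * v') (r * p' + v * r') (r * q' + v * v') := by
  ext i j
  fin_cases i <;> fin_cases j <;>
    simp [slTwoAdjoint, Matrix.mul_apply, Fin.sum_univ_three] <;> ring

lemma slTwoAdjoint_smul (c p q r v : R) :
    slTwoAdjoint (c * p) (c * q) (c * r) (c * v) = c ^ 2 • slTwoAdjoint p q r v := by
  ext i j
  fin_cases i <;> fin_cases j <;> simp [slTwoAdjoint] <;> ring

lemma slTwoAdjoint_one : slTwoAdjoint (1 : R) 0 0 1 = 1 := by
  ext i j
  fin_cases i <;> fin_cases j <;> simp [slTwoAdjoint]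

/-- By Cayley–Hamilton `M ^ (m + 1) = S (m + 1) • M - S m • 1` for the Chebyshev-type sequence
`S` of `tr M`; this is the induced statement on `sl₂`. -/
lemma slTwoAdjoint_pow {p q r v : R} (hdet : p * v - q * r = 1) {S : ℕ → R} (h0 : S 0 = 0)
    (h1 : S 1 = 1) (hS : ∀ m, S (m + 2) = (p + v) * S (m + 1) - S m) (m : ℕ) :
    slTwoAdjoint p q r v ^ (m + 1) =
      slTwoAdjoint (S (m + 1) * p - S m) (S (m + 1) * q) (S (m + 1) * r)
        (S (m + 1) * v - S m) := by
  induction m with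
  | zero => simp [h0, h1]
  | succ m ih =>
    rw [pow_succ, ih, slTwoAdjoint_mul, hS m]
    congr 1
    · linear_combination -S (m + 1) * hdet
    · ring
    · ring
    · linear_combination -S (m + 1) * hdet

/-- The quadratic invariant of the recurrence `S (m + 2) = t * S (m + 1) - S m`. -/
lemma sq_sub_mul_add_sq_eq_one {t : R} {S : ℕ → R} (h0 : S 0 = 0) (h1 : S 1 = 1)
    (hS : ∀ m, S (m + 2) = t * S (m + 1) - S m) (m : ℕ) :
    S (m + 1) ^ 2 - t * S (m + 1) * S m + S m ^ 2 = 1 := by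
  induction m with
  | zero => simp [h0, h1]
  | succ m ih =>
    rw [hS m]
    linear_combination ih

/-- `M` commutes with its traceless part, and the complementary factor of the characteristic
polynomial of the adjoint action is a multiple of the projection onto that part. -/
lemma slTwoAdjoint_sq_sub_smul_add_one {p q r v : R} (hdet : p * v - q * r = 1) :
    slTwoAdjoint p q r v ^ 2 - ((p + v) ^ 2 - 2) • slTwoAdjoint p q r v + 1 =
      !![-(2 * q * r), -(2 * q * (p - v)), -(2 * q ^ 2);
        -((p - v) * r), -(p - v) ^ 2, -((p - v) * q);
        -(2 * r ^ 2), -(2 * r * (p - v)), -(2 * q * r)] := by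
  rw [sq, slTwoAdjoint_mul]
  ext i j
  fin_cases i <;> fin_cases j <;> simp [slTwoAdjoint] <;> grind

/-- The eigenvalues of the adjoint action are `1` and the squares of the eigenvalues of `M`. -/
lemma slTwoAdjoint_cubic {p q r v : R} (hdet : p * v - q * r = 1) :
    (slTwoAdjoint p q r v - 1) * (slTwoAdjoint p q r v ^ 2
      - ((p + v) ^ 2 - 2) • slTwoAdjoint p q r v + 1) = 0 := by
  rw [slTwoAdjoint_sq_sub_smul_add_one hdet]
  ext i j
  fin_cases i <;> fin_cases j <;>
    simp [slTwoAdjoint, Matrix.mul_apply, Fin.sum_univ_three] <;> grind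

/-- A geometric sum of a matrix (or any algebra element) annihilated by
`(x - 1) * (x ^ 2 - c * x + 1)`. -/
lemma smul_geom_sum_of_cubic {A : Type*} [Ring A] [Algebra R A] {x : A} {c : R}
    (h : (x - 1) * (x ^ 2 - c • x + 1) = 0) (n : ℕ) :
    (c - 2) • ∑ j ∈ Finset.range n, x ^ j =
      (x ^ n - 1) * (x - (c - 1) • 1) - (n : R) • (x ^ 2 - c • x + 1) := by
  have hfix (m : ℕ) : x ^ m * (x ^ 2 - c • x + 1) = x ^ 2 - c • x + 1 := by
    induction m with
    | zero => simp
    | succ m ih =>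
      rw [sub_mul, one_mul, sub_eq_zero] at h
      rw [pow_succ, mul_assoc, h, ih]
  induction n with
  | zero => simp
  | succ n ih =>
    have hn := hfix n
    simp only [mul_add, mul_sub, mul_smul_comm, mul_one] at hn
    rw [Finset.sum_range_succ, smul_add, ih]
    simp only [mul_sub, sub_mul, mul_smul_comm, mul_one, one_mul, pow_succ, pow_zero, mul_assoc,
      Nat.cast_succ] at hn ⊢
    linear_combination (norm := module) -hn

end CommRing

lemma inv_smul_slTwoAdjoint_inv {K : Type*} [Field K] {d p q r v : K} (hd : d ≠ 0)
    (hdet : p * v - q * r = d) :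
    (d⁻¹ • slTwoAdjoint p q r v)⁻¹ = d⁻¹ • slTwoAdjoint v (-q) (-r) p := by
  apply Matrix.inv_eq_right_inv
  have h : slTwoAdjoint p q r v * slTwoAdjoint v (-q) (-r) p = d ^ 2 • 1 := by
    rw [slTwoAdjoint_mul, ← slTwoAdjoint_one, ← slTwoAdjoint_smul]
    congr 1 <;> first | ring1 | linear_combination hdet
  rw [smul_mul_smul_comm, h, smul_smul]
  have : d⁻¹ * d⁻¹ * d ^ 2 = 1 := by field_simp
  rw [this, one_smul]

/-- Proposition 4.2 of the paper: the explicit form of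
`Ω = I + W⁻¹ + ⋯ + W^{−(n−1)}` on the Riley variety. -/
theorem twist_knot_Omega_explicit
    (n : ℕ) (hn : 1 ≤ n)
    (s u : ℂ) (hs : s ≠ 0) (hu : u ≠ 0)
    (A B W Ω : Matrix (Fin 3) (Fin 3) ℂ)
    (hA : A = !![s, -2, -(1 / s); 0, 1, 1 / s; 0, 0, 1 / s])
    (hB : B = !![s, 0, 0; s * u, 1, 0; -(s * u ^ 2), -(2 * u), 1 / s])
    (hW : W = B * A⁻¹ * B⁻¹ * A)
    (hΩ : Ω = ∑ j ∈ Finset.range n, (W⁻¹) ^ j)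
    (ξp ξm : ℂ) (hprod : ξp * ξm = 1) (hne : ξp ≠ ξm)
    (hsum : ξp + ξm = 2 + 2 * u - u / s - s * u + u ^ 2)
    (X Y : ℂ)
    (hX : X = (ξp ^ n - ξm ^ n) / (ξp - ξm))
    (hY : Y = (ξp ^ (n - 1) - ξm ^ (n - 1)) / (ξp - ξm))
    (hRiley : (s + 1 / s - 1 - u) * X = Y)
    (hD0 : s ^ 2 * u * (1 - 2 * s + s ^ 2 - s * u) *
      (-(4 * s) + u - 2 * s * u + s ^ 2 * u - s * u ^ 2) ≠ 0)
    (hδ : u + 1 - 1 / s ≠ 0) :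
    Ω = (1 / (s ^ 2 * u * (1 - 2 * s + s ^ 2 - s * u) *
        (-(4 * s) + u - 2 * s * u + s ^ 2 * u - s * u ^ 2))) •
      !![s ^ 2 * u * ((1 - 2 * s + s ^ 2 - s * u) *
            (2 - 4 * s + 2 * s ^ 2 + u - 6 * s * u + s ^ 2 * u - 4 * s ^ 3 * u
              - s * u ^ 2 + 3 * s ^ 2 * u ^ 2 - s ^ 3 * u ^ 2 + s ^ 4 * u ^ 2
              - s ^ 3 * u ^ 3) * X ^ 2
            - 2 * n * s * (-1 + s + s * u) ^ 2),
        -(2 * s * u) * (-1 + s + s * u) * ((1 - 2 * s + s ^ 2 - s * u) *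
            (-1 - 3 * s ^ 2 + 2 * s * u - s ^ 2 * u + s ^ 3 * u - s ^ 2 * u ^ 2) * X ^ 2
            - n * s * (-1 + 2 * s + s ^ 2 + s * u)),
        -(-1 + s + s * u) ^ 2 * ((1 - 2 * s + s ^ 2 - s * u) *
            (-(2 * s) + u - s * u + s ^ 2 * u - s * u ^ 2) * X ^ 2
            - 2 * n * s ^ 2);
        s ^ 2 * u ^ 2 * (-1 + s + s * u) * ((1 - 2 * s + s ^ 2 - s * u) *
            (-1 - 3 * s ^ 2 + 2 * s * u - s ^ 2 * u + s ^ 3 * u - s ^ 2 * u ^ 2) * X ^ 2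
            - n * s * (-1 + 2 * s + s ^ 2 + s * u)),
        -(s * u) * (2 * (1 - 2 * s + s ^ 2 - s * u) * (-1 + s + s * u) ^ 2 *
            (-(2 * s) + u - s * u + s ^ 2 * u - s * u ^ 2) * X ^ 2
            - n * s * u * (-1 + 2 * s + s ^ 2 + s * u) ^ 2),
        -u * (-1 + s + s * u) * ((1 - 2 * s + s ^ 2 - s * u) * (-1 + s + s * u) *
            (-(3 * s) + s ^ 2 + u - 2 * s * u + s ^ 2 * u - s * u ^ 2) * X ^ 2
            - n * s ^ 2 * (-1 + 2 * s + s ^ 2 + s * u));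
        -(s ^ 2 * u ^ 2) * (-1 + s + s * u) ^ 2 * ((1 - 2 * s + s ^ 2 - s * u) *
            (-(2 * s) + u - s * u + s ^ 2 * u - s * u ^ 2) * X ^ 2
            - 2 * n * s ^ 2),
        2 * s * u ^ 2 * (-1 + s + s * u) * ((1 - 2 * s + s ^ 2 - s * u) * (-1 + s + s * u) *
            (-(3 * s) + s ^ 2 + u - 2 * s * u + s ^ 2 * u - s * u ^ 2) * X ^ 2
            - n * s ^ 2 * (-1 + 2 * s + s ^ 2 + s * u)),
        u * (-1 + s + s * u) * ((1 - 2 * s + s ^ 2 - s * u) *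
            (-(2 * s ^ 2) + 2 * s ^ 3 + 4 * s * u - 9 * s ^ 2 * u + 3 * s ^ 3 * u
              - u ^ 2 + 4 * s * u ^ 2 - 9 * s ^ 2 * u ^ 2 + 3 * s ^ 3 * u ^ 2
              + 2 * s * u ^ 3 - 4 * s ^ 2 * u ^ 3 + s ^ 3 * u ^ 3 - s ^ 2 * u ^ 4) * X ^ 2
            - 2 * n * s ^ 3 * (-1 + s + s * u))] := by
  obtain ⟨m, rfl⟩ : ∃ m, n = m + 1 := ⟨n - 1, by omega⟩
  obtain ⟨p, hp⟩ : ∃ p, p = (u + 1) ^ 2 - u / s := ⟨_, rfl⟩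
  obtain ⟨q, hq⟩ : ∃ q, q = u + 1 - 1 / s := ⟨_, rfl⟩
  obtain ⟨r, hr⟩ : ∃ r, r = -(u * (s * u + s - 1)) := ⟨_, rfl⟩
  obtain ⟨v, hv⟩ : ∃ v, v = 1 - s * u := ⟨_, rfl⟩
  have hdet : p * v - q * r = 1 := by
    rw [hp, hq, hr, hv]; field_simp; ring
  have ht : ξp + ξm = p + v := by
    rw [hsum, hp, hv]; ring
  have hA' : A = s⁻¹ • slTwoAdjoint s 1 0 1 := by
    rw [hA]
    ext i j
    fin_cases i <;> fin_cases j <;> simp [slTwoAdjoint] <;> field_simp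
  have hB' : B = s⁻¹ • slTwoAdjoint s 0 (-(s * u)) 1 := by
    rw [hB]
    ext i j
    fin_cases i <;> fin_cases j <;> simp [slTwoAdjoint] <;> field_simp
  have hW' : W = slTwoAdjoint v (-q) (-r) p := by
    rw [hW, hA', hB', inv_smul_slTwoAdjoint_inv hs (by ring),
      inv_smul_slTwoAdjoint_inv hs (by ring)]
    simp only [smul_mul_smul_comm, slTwoAdjoint_mul]
    have hs4 : s⁻¹ * s⁻¹ * s⁻¹ * s⁻¹ = (s⁻¹ ^ 2) ^ 2 := by ring
    rw [hs4, ← slTwoAdjoint_smul, hp, hq, hr, hv]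
    congr 1 <;> field_simp <;> ring
  have hWinv : W⁻¹ = slTwoAdjoint p q r v := by
    have h := inv_smul_slTwoAdjoint_inv (d := 1) (p := v) (q := -q) (r := -r) (v := p) one_ne_zero
      (by linear_combination hdet)
    rw [hW']
    simpa using h
  have hξ : ξp - ξm ≠ 0 := sub_ne_zero.2 hne
  obtain ⟨S, hS⟩ : ∃ S : ℕ → ℂ, ∀ k, S k = (ξp ^ k - ξm ^ k) / (ξp - ξm) := ⟨_, fun _ => rfl⟩
  have hS0 : S 0 = 0 := by simp [hS]
  have hS1 : S 1 = 1 := by simp [hS, hξ]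
  have hSrec (k : ℕ) : S (k + 2) = (p + v) * S (k + 1) - S k := by
    rw [hS, hS, hS, ← ht]
    field_simp
    linear_combination (ξm ^ k - ξp ^ k) * hprod
  rw [add_tsub_cancel_right, ← hS] at hY
  rw [← hS] at hX
  have hpow := slTwoAdjoint_pow hdet hS0 hS1 hSrec m
  have hinv := sq_sub_mul_add_sq_eq_one hS0 hS1 hSrec m
  have hgeom := smul_geom_sum_of_cubic (slTwoAdjoint_cubic hdet) (m + 1)
  rw [← hX, ← hY] at hpow hinv
  rw [← hWinv, ← hΩ, hWinv, hpow, slTwoAdjoint_sq_sub_smul_add_one hdet] at hgeom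
  have hD : s ^ 2 * u * (1 - 2 * s + s ^ 2 - s * u) *
      (-(4 * s) + u - 2 * s * u + s ^ 2 * u - s * u ^ 2) =
      s ^ 4 * ((p + v) ^ 2 - 2 - 2) := by
    rw [hp, hv]; field_simp; ring
  rw [one_div, eq_inv_smul_iff₀ hD0, hD, mul_smul, hgeom]
  have hone (N : Matrix (Fin 3) (Fin 3) ℂ) :
      N - 1 = N - (X ^ 2 - (p + v) * X * Y + Y ^ 2) • (1 : Matrix (Fin 3) (Fin 3) ℂ) := by
    rw [hinv, one_smul]
  rw [hone, ← hRiley, hp, hq, hr, hv]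
  ext i j
  fin_cases i <;> fin_cases j <;>
    simp [slTwoAdjoint, Matrix.mul_apply, Fin.sum_univ_three] <;> field_simp <;> ring
end

section
/- Under the hypotheses of Theorem 4.1 (n ≥ 1, s ≠ 0, u ≠ 0, A, B, W = BA⁻¹B⁻¹A, Ω = I + W⁻¹ + ⋯ + W^{−(n−1)}, eigenvalue parameters ξ₊ξ₋ = 1, ξ₊ ≠ ξ₋, ξ₊ + ξ₋ = 2 + 2u − u/s − su + u², the Riley equation (s + 1/s − 1 − u)(ξ₊ⁿ − ξ₋ⁿ)/(ξ₊ − ξ₋) = (ξ₊^{n−1} − ξ₋^{n−1})/(ξ₊ − ξ₋), x² = s + 1/s + 2, y = u + 2, and the nonvanishing conditions (y+2−x²) ≠ 0, (y²−yx²+x²) ≠ 0, (y²−yx²+2x²) ≠ 0, u + 1 − 1/s ≠ 0, (1−2s+s²−su) ≠ 0), define Δ(t) = det(I + (I − t·A)·Ω·(t⁻¹·A⁻¹ − A⁻¹·B)) / det(t·B − I) for t ≠ 0 with det(t·B − I) ≠ 0. Then as t → 1 with t ≠ 1, the quotient Δ(t)/(t − 1) tends to (1/((y+2−x²)(y²−yx²+x²)))·(((2n−1)y²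 + yx² − 2n·x²(x²−2))/(y²−yx²+2x²) + 2n); equivalently, −lim_{t→1} Δ(t)/(t−1) = −(1/((y+2−x²)(y²−yx²+x²)))·(((2n−1)y² + yx² − 2n·x²(x²−2))/(y²−yx²+2x²) + 2n). -/
open Matrix Filter

namespace TwistKnot

/-- The matrix of `ad V`, where `V` is the `SL₂`-matrix of `W⁻¹`. -/
noncomputable def adMatrix (s u : ℂ) : Matrix (Fin 3) (Fin 3) ℂ :=
  !![u * (s + 2 + u - 1 / s), -(2 * (u + 1 - 1 / s)), 0;
    s * u * (u + 1 - 1 / s), 0, u + 1 - 1 / s;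
    0, -(2 * (s * u * (u + 1 - 1 / s))), -(u * (s + 2 + u - 1 / s))]

/-- The trace of the `SL₂`-matrix of `W`. -/
noncomputable def traceW (s u : ℂ) : ℂ := 2 + 2 * u - u / s - s * u + u ^ 2

theorem adMatrix_cube (s u : ℂ) (hs : s ≠ 0) :
    adMatrix s u * (adMatrix s u * adMatrix s u) = (traceW s u ^ 2 - 4) • adMatrix s u := by
  ext i j
  fin_cases i <;> fin_cases j <;>
    simp [adMatrix, traceW, Matrix.mul_apply, Fin.sum_univ_three] <;> field_simp <;> ring

theorem inv_A (s : ℂ) (hs : s ≠ 0) :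
    (!![s, -2, -(1 / s); 0, 1, 1 / s; 0, 0, 1 / s] : Matrix (Fin 3) (Fin 3) ℂ)⁻¹ =
      !![1 / s, 2 / s, -(1 / s); 0, 1, -1; 0, 0, s] := by
  apply Matrix.inv_eq_right_inv
  ext i j
  fin_cases i <;> fin_cases j <;>
    simp [Matrix.mul_apply, Fin.sum_univ_three, hs] <;> field_simp <;> ring

theorem inv_B (s u : ℂ) (hs : s ≠ 0) :
    (!![s, 0, 0; s * u, 1, 0; -(s * u ^ 2), -(2 * u), 1 / s] : Matrix (Fin 3) (Fin 3) ℂ)⁻¹ =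
      !![1 / s, 0, 0; -u, 1, 0; -(s * u ^ 2), 2 * s * u, s] := by
  apply Matrix.inv_eq_right_inv
  ext i j
  fin_cases i <;> fin_cases j <;>
    simp [Matrix.mul_apply, Fin.sum_univ_three, hs] <;> field_simp <;> ring

theorem inv_W (s u : ℂ) (hs : s ≠ 0) (A B : Matrix (Fin 3) (Fin 3) ℂ)
    (hA : A = !![s, -2, -(1 / s); 0, 1, 1 / s; 0, 0, 1 / s])
    (hB : B = !![s, 0, 0; s * u, 1, 0; -(s * u ^ 2), -(2 * u), 1 / s]) :
    (B * A⁻¹ * B⁻¹ * A)⁻¹ = 1 + (traceW s u / 2) • adMatrix s u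
      + (1 / 2 : ℂ) • (adMatrix s u * adMatrix s u) := by
  have hdA : IsUnit A.det := by
    rw [hA, Matrix.det_fin_three]; simp [hs]
  have hdB : IsUnit B.det := by
    rw [hB, Matrix.det_fin_three]; simp [hs]
  rw [Matrix.mul_inv_rev, Matrix.mul_inv_rev, Matrix.mul_inv_rev,
    Matrix.nonsing_inv_nonsing_inv _ hdA, Matrix.nonsing_inv_nonsing_inv _ hdB, hA, inv_A s hs, hB,
    inv_B s u hs]
  ext i j
  fin_cases i <;> fin_cases j <;>
    simp [adMatrix, traceW, Matrix.mul_apply, Fin.sum_univ_three] <;> field_simp <;> ring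

theorem chebyshev_invariant (τ : ℂ) (p : ℕ → ℂ) (h0 : p 0 = 0) (h1 : p 1 = 1)
    (hp : ∀ k, p (k + 2) = τ * p (k + 1) - p k) (k : ℕ) :
    p (k + 1) ^ 2 + p k ^ 2 - τ * p (k + 1) * p k = 1 := by
  induction k with
  | zero => simp [h0, h1]
  | succ k ih => rw [hp k]; linear_combination ih

/-- A partial geometric sum for `M = 1 + (τ/2) L + L²/2` with `L³ = (τ² - 4) L`. -/
theorem geom_sum_eq {R : Type*} [Ring R] [Algebra ℂ R] (L : R) (τ : ℂ)
    (hD : τ ^ 2 - 4 ≠ 0) (hL : L * (L * L) = (τ ^ 2 - 4) • L) (p : ℕ → ℂ)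
    (h0 : p 0 = 0) (h1 : p 1 = 1) (hp : ∀ k, p (k + 2) = τ * p (k + 1) - p k) (k : ℕ) :
    ∑ j ∈ Finset.range (k + 1), (1 + (τ / 2) • L + (1 / 2 : ℂ) • (L * L)) ^ j =
      ((k : ℂ) + 1) • (1 : R) + (p (k + 1) * p k / 2) • L
        + ((p (k + 1) ^ 2 - p k ^ 2 + 1 - 2 * (k + 1)) / (2 * (τ ^ 2 - 4))) • (L * L) := by
  induction k with
  | zero => norm_num [h0, h1]
  | succ k ih =>
    rw [Finset.sum_range_succ', Finset.sum_congr rfl fun j _ => pow_succ' _ j, ← Finset.mul_sum, ih]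
    simp only [add_mul, mul_add, smul_mul_assoc, mul_smul_comm, one_mul, mul_one, mul_assoc, hL,
      pow_zero]
    have hk := chebyshev_invariant τ p h0 h1 hp k
    rw [hp k]
    match_scalars
    · ring
    · field_simp
      linear_combination (-τ) * hk
    · field_simp
      linear_combination (-τ ^ 2) * hk

/-- The determinant of the inverse of `Ω`, a quadratic polynomial in `adMatrix s u`. -/
theorem det_inverse (s u x2 y c h₁ h₂ h₃ β κ : ℂ) (hs : s ≠ 0)
    (hx : x2 = s + 1 / s + 2) (hy : y = u + 2) (hc : c = x2 - y - 1)
    (hh₁ : h₁ = y + 2 - x2) (hh₂ : h₂ = y ^ 2 - y * x2 + x2) (hh₃ : h₃ = y ^ 2 - y * x2 + 2 * x2)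
    (hκ : κ = h₁ * (h₃ - y) / 2 - u * h₁ * h₃ * β) :
    (κ • (1 : Matrix (Fin 3) (Fin 3) ℂ) - (c / 2) • adMatrix s u
      + β • (adMatrix s u * adMatrix s u)).det = κ * (h₁ * h₂) := by
  subst hκ hh₁ hh₂ hh₃ hc hy hx
  simp [adMatrix, Matrix.det_fin_three]
  field_simp
  ring

theorem adMatrix_quadratic (s u κ d β δ l : ℂ) (hδ : δ = u + 1 - 1 / s)
    (hl : l = u * (s + 2 + u - 1 / s)) :
    κ • (1 : Matrix (Fin 3) (Fin 3) ℂ) - d • adMatrix s u + β • (adMatrix s u * adMatrix s u) =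
      !![κ - d * l + β * (l ^ 2 - 2 * s * u * δ ^ 2), 2 * d * δ - 2 * β * l * δ, -(2 * β * δ ^ 2);
        s * u * δ * (β * l - d), κ - 4 * β * s * u * δ ^ 2, -(δ * (d + β * l));
        -(2 * β * (s * u * δ) ^ 2), 2 * (s * u * δ) * (d + β * l),
          κ + d * l + β * (l ^ 2 - 2 * s * u * δ ^ 2)] := by
  rw [adMatrix, ← hδ, ← hl]
  ext i j
  fin_cases i <;> fin_cases j <;>
    simp [-mul_eq_mul_left_iff, -mul_eq_mul_right_iff] <;> ring

theorem pencil_eq (s u t r g₀₀ g₀₁ g₀₂ g₁₀ g₁₁ g₁₂ g₂₀ g₂₁ g₂₂ : ℂ) :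
    (t • (!![s, -2, -r; 0, 1, r; 0, 0, r] *
        !![g₀₀, g₀₁, g₀₂; g₁₀, g₁₁, g₁₂; g₂₀, g₂₁, g₂₂]) +
      (1 - t • !![s, 0, 0; s * u, 1, 0; -(s * u ^ 2), -(2 * u), r]) *
        (1 - t • !![s, -2, -r; 0, 1, r; 0, 0, r]) : Matrix (Fin 3) (Fin 3) ℂ) =
      !![t * (s * g₀₀ - 2 * g₁₀ - r * g₂₀) + (1 - t * s) ^ 2,
        t * (s * g₀₁ - 2 * g₁₁ - r * g₂₁) + (1 - t * s) * (2 * t),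
        t * (s * g₀₂ - 2 * g₁₂ - r * g₂₂) + (1 - t * s) * (t * r);
        t * (g₁₀ + r * g₂₀) - t * s * u * (1 - t * s),
        t * (g₁₁ + r * g₂₁) - t * s * u * (2 * t) + (1 - t) ^ 2,
        t * (g₁₂ + r * g₂₂) - t * s * u * (t * r) - (1 - t) * (t * r);
        t * (r * g₂₀) + t * s * u ^ 2 * (1 - t * s),
        t * (r * g₂₁) + t * s * u ^ 2 * (2 * t) + 2 * t * u * (1 - t),
        t * (r * g₂₂) + t * s * u ^ 2 * (t * r) - 2 * t * u * (t * r) + (1 - t * r) ^ 2] := by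
  ext i j
  fin_cases i <;> fin_cases j <;>
    simp [Matrix.mul_apply, Fin.sum_univ_three, Matrix.one_apply, -mul_eq_mul_left_iff,
      -mul_eq_mul_right_iff] <;> ring

set_option maxHeartbeats 4000000 in
/-- The numerator of `Δ` is, up to `det Ω` and a power of `t`, the left-hand determinant. -/
theorem det_numerator (s u t x2 y c h₁ h₃ β κ : ℂ) (hs : s ≠ 0)
    (A B : Matrix (Fin 3) (Fin 3) ℂ)
    (hA : A = !![s, -2, -(1 / s); 0, 1, 1 / s; 0, 0, 1 / s])
    (hB : B = !![s, 0, 0; s * u, 1, 0; -(s * u ^ 2), -(2 * u), 1 / s])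
    (hx : x2 = s + 1 / s + 2) (hy : y = u + 2) (hc : c = x2 - y - 1)
    (hh₁ : h₁ = y + 2 - x2) (hh₃ : h₃ = y ^ 2 - y * x2 + 2 * x2)
    (hκ : κ = h₁ * (h₃ - y) / 2 - u * h₁ * h₃ * β) :
    (t • (A * (κ • (1 : Matrix (Fin 3) (Fin 3) ℂ) - (c / 2) • adMatrix s u
      + β • (adMatrix s u * adMatrix s u))) + (1 - t • B) * (1 - t • A)).det =
      (t - 1) ^ 2 * (t * s - 1) * (t * (1 / s) - 1) *
        (t ^ 2 + (h₁ * (2 * x2 - h₃ + y) / 2 - x2 + 2 - u * h₁ * y * (x2 - y) * β) * t + 1) := by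
  rw [adMatrix_quadratic s u κ (c / 2) β _ _ rfl rfl, hA, hB, pencil_eq, Matrix.det_fin_three]
  subst hκ hh₁ hh₃ hc hy hx
  simp only [Matrix.of_apply, Matrix.cons_val', Matrix.cons_val_zero, Matrix.cons_val_one,
    Matrix.cons_val]
  field_simp
  ring

theorem quadratic_mul_quadratic {R : Type*} [Ring R] [Algebra ℂ R] (L : R) (D : ℂ)
    (hL : L * (L * L) = D • L) (m a b κ d β : ℂ) (h0 : m * κ = 1)
    (h1 : a * κ - m * d + D * (a * β - b * d) = 0)
    (h2 : m * β - a * d + b * κ + D * b * β = 0) :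
    (m • (1 : R) + a • L + b • (L * L)) * (κ • (1 : R) - d • L + β • (L * L)) = 1 := by
  simp only [add_mul, mul_add, mul_sub, smul_mul_assoc, mul_smul_comm, one_mul, mul_one,
    mul_assoc, hL]
  match_scalars
  · linear_combination h0
  · linear_combination h1
  · linear_combination h2

/-- The inverse of `Ω` when `p` satisfies the Riley equation `c * p (k + 1) = p k`. -/
theorem geom_sum_mul_inverse (s u x2 y c h₁ h₂ h₃ β κ : ℂ) (k : ℕ) (hs : s ≠ 0) (hu : u ≠ 0)
    (hx : x2 = s + 1 / s + 2) (hy : y = u + 2) (hc : c = x2 - y - 1)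
    (hh₁ : h₁ = y + 2 - x2) (hh₂ : h₂ = y ^ 2 - y * x2 + x2) (hh₃ : h₃ = y ^ 2 - y * x2 + 2 * x2)
    (h₁0 : h₁ ≠ 0) (h₂0 : h₂ ≠ 0) (h₃0 : h₃ ≠ 0)
    (hκ : κ = 1 / ((k : ℂ) + 1)) (hβ : β = (h₃ - y) / (2 * u * h₃) - κ / (u * h₁ * h₃))
    (p : ℕ → ℂ) (h0 : p 0 = 0) (h1 : p 1 = 1)
    (hp : ∀ k, p (k + 2) = traceW s u * p (k + 1) - p k) (hR : c * p (k + 1) = p k) :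
    (∑ j ∈ Finset.range (k + 1), (1 + (traceW s u / 2) • adMatrix s u
        + (1 / 2 : ℂ) • (adMatrix s u * adMatrix s u)) ^ j) *
      (κ • (1 : Matrix (Fin 3) (Fin 3) ℂ) - (c / 2) • adMatrix s u
        + β • (adMatrix s u * adMatrix s u)) = 1 := by
  have hk : (k : ℂ) + 1 ≠ 0 := Nat.cast_add_one_ne_zero k
  have hτ : traceW s u = h₃ - 2 := by
    rw [traceW, hh₃, hy, hx]; field_simp; ring
  have hD : traceW s u ^ 2 - 4 = u * h₁ * h₃ := by
    rw [hτ, hh₃, hh₁, hy]; ring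
  have hinv : p (k + 1) ^ 2 * (h₁ * h₂) = 1 := by
    have := chebyshev_invariant _ p h0 h1 hp k
    rw [← hR, hτ, hh₃] at this
    rw [← this, hh₁, hh₂, hc]
    ring
  have hP : p (k + 1) ^ 2 = 1 / (h₁ * h₂) := by
    rw [eq_div_iff (mul_ne_zero h₁0 h₂0), hinv]
  have hL := adMatrix_cube s u hs
  rw [geom_sum_eq _ _ (by rw [hD]; simp [hu, h₁0, h₃0]) hL p h0 h1 hp, ← hR]
  have ha : p (k + 1) * (c * p (k + 1)) / 2 = c / (2 * (h₁ * h₂)) := by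
    linear_combination c / 2 * hP
  have hb : p (k + 1) ^ 2 - (c * p (k + 1)) ^ 2 + 1 - 2 * ((k : ℂ) + 1) =
      (1 - c ^ 2) / (h₁ * h₂) + 1 - 2 * ((k : ℂ) + 1) := by
    linear_combination (1 - c ^ 2) * hP
  rw [ha, hb]
  rw [hD] at hL ⊢
  have hu' : u = y - 2 := by rw [hy]; ring
  apply quadratic_mul_quadratic _ _ hL
  · rw [hκ]; field_simp
  · rw [hβ, hκ]; field_simp
    rw [hh₁, hh₂, hh₃, hc]; ring
  · rw [hβ, hκ]; field_simp
    rw [hh₁, hh₂, hh₃, hc, hu']; ring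

end TwistKnot

open TwistKnot

/-- Corollary 4.5 of the paper: the non-abelian Reidemeister torsion of the
twist knot `J(2,2n)` is obtained as `−lim_{t→1} Δ_{K,Ad∘ρ}(t)/(t−1)`. -/
theorem twist_knot_nonabelian_reidemeister_torsion
    (n : ℕ) (hn : 1 ≤ n)
    (s u : ℂ) (hs : s ≠ 0) (hu : u ≠ 0)
    (A B W Ω : Matrix (Fin 3) (Fin 3) ℂ)
    (hA : A = !![s, -2, -(1 / s); 0, 1, 1 / s; 0, 0, 1 / s])
    (hB : B = !![s, 0, 0; s * u, 1, 0; -(s * u ^ 2), -(2 * u), 1 / s])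
    (hW : W = B * A⁻¹ * B⁻¹ * A)
    (hΩ : Ω = ∑ j ∈ Finset.range n, (W⁻¹) ^ j)
    (ξp ξm : ℂ) (hprod : ξp * ξm = 1) (hne : ξp ≠ ξm)
    (hsum : ξp + ξm = 2 + 2 * u - u / s - s * u + u ^ 2)
    (hRiley : (s + 1 / s - 1 - u) * ((ξp ^ n - ξm ^ n) / (ξp - ξm)) =
      (ξp ^ (n - 1) - ξm ^ (n - 1)) / (ξp - ξm))
    (x y : ℂ) (hx : x ^ 2 = s + 1 / s + 2) (hy : y = u + 2)
    (h1 : y + 2 - x ^ 2 ≠ 0)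
    (h2 : y ^ 2 - y * x ^ 2 + x ^ 2 ≠ 0)
    (h3 : y ^ 2 - y * x ^ 2 + 2 * x ^ 2 ≠ 0)
    (hδ : u + 1 - 1 / s ≠ 0)
    (h4 : 1 - 2 * s + s ^ 2 - s * u ≠ 0)
    (Δ : ℂ → ℂ)
    (hΔ : ∀ t : ℂ, Δ t =
      (1 + (1 - t • A) * Ω * (t⁻¹ • A⁻¹ - A⁻¹ * B)).det / (t • B - 1).det) :
    Tendsto (fun t : ℂ => Δ t / (t - 1))
      (nhdsWithin 1 {t : ℂ | t ≠ 1 ∧ t ≠ 0 ∧ (t • B - 1).det ≠ 0})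
      (nhds ((1 / ((y + 2 - x ^ 2) * (y ^ 2 - y * x ^ 2 + x ^ 2))) *
        (((2 * n - 1) * y ^ 2 + y * x ^ 2 - 2 * n * x ^ 2 * (x ^ 2 - 2)) /
          (y ^ 2 - y * x ^ 2 + 2 * x ^ 2) + 2 * n)))
    ∧
    Tendsto (fun t : ℂ => -(Δ t / (t - 1)))
      (nhdsWithin 1 {t : ℂ | t ≠ 1 ∧ t ≠ 0 ∧ (t • B - 1).det ≠ 0})
      (nhds (-((1 / ((y + 2 - x ^ 2) * (y ^ 2 - y * x ^ 2 + x ^ 2))) *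
        (((2 * n - 1) * y ^ 2 + y * x ^ 2 - 2 * n * x ^ 2 * (x ^ 2 - 2)) /
          (y ^ 2 - y * x ^ 2 + 2 * x ^ 2) + 2 * n)))) := by
  obtain ⟨k, rfl⟩ : ∃ k, n = k + 1 := ⟨n - 1, by omega⟩
  rw [Nat.add_sub_cancel] at hRiley
  have hξ : ξp - ξm ≠ 0 := sub_ne_zero.mpr hne
  have hk : (k : ℂ) + 1 ≠ 0 := Nat.cast_add_one_ne_zero k
  set x2 : ℂ := x ^ 2 with hx2
  set c : ℂ := x2 - y - 1 with hc
  set h₁ : ℂ := y + 2 - x2 with hh₁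
  set h₂ : ℂ := y ^ 2 - y * x2 + x2 with hh₂
  set h₃ : ℂ := y ^ 2 - y * x2 + 2 * x2 with hh₃
  set κ : ℂ := 1 / ((k : ℂ) + 1) with hκ
  set β : ℂ := (h₃ - y) / (2 * u * h₃) - κ / (u * h₁ * h₃) with hβ
  have hκβ : κ = h₁ * (h₃ - y) / 2 - u * h₁ * h₃ * β := by
    rw [hβ]; field_simp; ring
  set G : Matrix (Fin 3) (Fin 3) ℂ :=
    κ • (1 : Matrix (Fin 3) (Fin 3) ℂ) - (c / 2) • adMatrix s u
      + β • (adMatrix s u * adMatrix s u) with hG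
  have hΩG : Ω * G = 1 := by
    rw [hΩ, hW, inv_W s u hs A B hA hB]
    refine geom_sum_mul_inverse s u x2 y c h₁ h₂ h₃ β κ k hs hu hx hy hc hh₁ hh₂ hh₃ h1 h2 h3
      hκ hβ (fun j => (ξp ^ j - ξm ^ j) / (ξp - ξm)) (by simp) (by simp [hξ]) (fun j => ?_) ?_
    · rw [traceW, ← hsum]
      field_simp
      linear_combination (ξm ^ j - ξp ^ j) * hprod
    · rw [← hRiley, hc, hx, hy]
      ring
  have hdetG : G.det = κ * (h₁ * h₂) :=
    det_inverse s u x2 y c h₁ h₂ h₃ β κ hs hx hy hc hh₁ hh₂ hh₃ hκβ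
  have hdetΩ : Ω.det = (k + 1) / (h₁ * h₂) := by
    have h := congrArg Matrix.det hΩG
    rw [Matrix.det_mul, hdetG, Matrix.det_one, hκ] at h
    field_simp at h ⊢
    linear_combination h
  have hdetA : A.det = 1 := by
    rw [hA, Matrix.det_fin_three]; simp [hs]
  have hdetB : ∀ t : ℂ, (t • B - 1).det = (t - 1) * ((t * s - 1) * (t * (1 / s) - 1)) := by
    intro t
    rw [hB, Matrix.det_fin_three]
    simp
    ring
  have hunit : IsUnit A.det := by simp [hdetA]
  set T : ℂ := h₁ * (2 * x2 - h₃ + y) / 2 - x2 + 2 - u * h₁ * y * (x2 - y) * β with hT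
  have hnum : ∀ t : ℂ, t ≠ 0 →
      (1 + (1 - t • A) * Ω * (t⁻¹ • A⁻¹ - A⁻¹ * B)).det =
        (t⁻¹) ^ 3 * ((t - 1) ^ 2 * (t * s - 1) * (t * (1 / s) - 1) * (t ^ 2 + T * t + 1)) *
          ((k + 1) / (h₁ * h₂)) := by
    intro t ht
    have hfac : 1 + (t⁻¹ • A⁻¹ - A⁻¹ * B) * ((1 - t • A) * Ω) =
        t⁻¹ • A⁻¹ * (t • (A * G) + (1 - t • B) * (1 - t • A)) * Ω := by
      have hY : t⁻¹ • A⁻¹ - A⁻¹ * B = t⁻¹ • A⁻¹ * (1 - t • B) := by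
        rw [mul_sub, mul_one, smul_mul_smul_comm, inv_mul_cancel₀ ht, one_smul]
      rw [hY, mul_add, add_mul, smul_mul_smul_comm, inv_mul_cancel₀ ht, one_smul,
        Matrix.nonsing_inv_mul_cancel_left _ _ hunit, mul_eq_one_comm.mp hΩG]
      simp only [mul_assoc]
    rw [Matrix.det_one_add_mul_comm, hfac, Matrix.det_mul, Matrix.det_mul, Matrix.det_smul,
      Matrix.det_nonsing_inv, hdetA, hdetΩ,
      det_numerator s u t x2 y c h₁ h₃ β κ hs A B hA hB hx hy hc hh₁ hh₃ hκβ,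
      Fintype.card_fin, Ring.inverse_one, mul_one, ← hT]
  have hlim : (1 / (h₁ * h₂)) * (((2 * ((k + 1 : ℕ) : ℂ) - 1) * y ^ 2 + y * x2 -
      2 * ((k + 1 : ℕ) : ℂ) * x2 * (x2 - 2)) / h₃ + 2 * ((k + 1 : ℕ) : ℂ)) =
      ((1 : ℂ)⁻¹) ^ 3 * (1 ^ 2 + T * 1 + 1) * ((k + 1) / (h₁ * h₂)) := by
    have hTκ : T * h₃ = 2 * (y ^ 2 - x2 * (x2 - 2)) + κ * (y * x2 - y ^ 2) := by
      rw [hκβ, hT, hh₁, hh₃]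
      ring
    have hκ1 : κ * (k + 1) = 1 := by rw [hκ]; field_simp
    push_cast
    field_simp
    linear_combination (-((k : ℂ) + 1)) * hTκ - (y * x2 - y ^ 2) * hκ1
  have hmain : Tendsto (fun t : ℂ => Δ t / (t - 1))
      (nhdsWithin 1 {t : ℂ | t ≠ 1 ∧ t ≠ 0 ∧ (t • B - 1).det ≠ 0})
      (nhds ((1 / (h₁ * h₂)) * (((2 * ((k + 1 : ℕ) : ℂ) - 1) * y ^ 2 + y * x2 -
        2 * ((k + 1 : ℕ) : ℂ) * x2 * (x2 - 2)) / h₃ + 2 * ((k + 1 : ℕ) : ℂ)))) := by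
    have hcont : ContinuousAt
        (fun t : ℂ => t⁻¹ ^ 3 * (t ^ 2 + T * t + 1) * ((k + 1) / (h₁ * h₂))) 1 := by
      fun_prop (disch := norm_num)
    rw [hlim]
    refine (hcont.tendsto.mono_left nhdsWithin_le_nhds).congr' ?_
    filter_upwards [self_mem_nhdsWithin] with t ht
    obtain ⟨ht1, ht0, htB⟩ := ht
    have ht1' : t - 1 ≠ 0 := sub_ne_zero.mpr ht1
    rw [hdetB] at htB
    rw [hΔ, hnum t ht0, hdetB, div_div, eq_div_iff (mul_ne_zero htB ht1')]
    ring
  exact ⟨hmain, hmain.neg⟩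
end
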